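/- arXiv:1302.2950 — 2 statements merged into one kernel-verified Lean document; each statement's English description precedes it below -/
import Mathlib

section
/- Let μ be a left Haar measure on the topological group SL(2,ℝ). Then there exist constants 0 < c ≤ C such that for every T ≥ 1, c·e^T ≤ μ({g ∈ SL(2,ℝ) : dist(g•i, i) ≤ T}) ≤ C·e^T. -/
open scoped MatrixGroups ENNReal
open UpperHalfPlane MeasureTheory

noncomputable section

instance : TopologicalSpace SL(2, ℝ) :=
  TopologicalSpace.induced ((↑) : SL(2, ℝ) → Matrix (Fin 2) (Fin 2) ℝ) inferInstance

instance : MeasurableSpace SL(2, ℝ) := borel _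

instance : BorelSpace SL(2, ℝ) := ⟨rfl⟩

instance : IsTopologicalGroup SL(2, ℝ) := Matrix.SpecialLinearGroup.topologicalGroup

lemma proper_orbit : IsProperMap fun g : SL(2, ℝ) ↦ g • I := isProperMap_smul_I

instance : SecondCountableTopology SL(2, ℝ) := by
  have h : Topology.IsInducing ((↑) : SL(2, ℝ) → Matrix (Fin 2) (Fin 2) ℝ) := ⟨rfl⟩
  have : SecondCountableTopology (Matrix (Fin 2) (Fin 2) ℝ) :=
    inferInstanceAs (SecondCountableTopology (Fin 2 → Fin 2 → ℝ))
  exact h.secondCountableTopology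

instance : SigmaCompactSpace SL(2, ℝ) := by
  refine ⟨⟨fun n : ℕ ↦ (fun g : SL(2, ℝ) ↦ g • I) ⁻¹' Metric.closedBall I n, fun n ↦
    proper_orbit.isCompact_preimage (isCompact_closedBall _ _), ?_⟩⟩
  ext g
  simp only [Set.mem_iUnion, Set.mem_preimage, Metric.mem_closedBall, Set.mem_univ, iff_true]
  exact exists_nat_ge _

/-- the ball in the group -/
def BB (T : ℝ) : Set SL(2, ℝ) := {g | dist (g • I) I ≤ T}

lemma vol_ball (g : SL(2, ℝ)) (r : ℝ) :
    volume (Metric.closedBall (g • I) r) = volume (Metric.closedBall I r) := by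
  have h := measure_preimage_smul (μ := (volume : Measure ℍ)) (g : GL (Fin 2) ℝ)
    (Metric.closedBall (g • I) r)
  rw [← h]
  congr 1
  ext z
  have : (g : GL (Fin 2) ℝ) • z = g • z := rfl
  simp only [Set.mem_preimage, Metric.mem_closedBall, this, dist_smul]

lemma haar_ball (μ : Measure SL(2, ℝ)) [μ.IsHaarMeasure] (z : ℍ) (r : ℝ) :
    μ {g | dist z (g • I) ≤ r} = μ (BB r) := by
  obtain ⟨h, rfl⟩ := MulAction.exists_smul_eq SL(2, ℝ) I z
  rw [← measure_preimage_mul μ h]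
  congr 1
  ext g
  simp [BB, mul_smul, dist_smul, dist_comm]

lemma fubini_id (μ : Measure SL(2, ℝ)) [μ.IsHaarMeasure] (R r : ℝ) :
    ∫⁻ g, volume (Metric.closedBall I R ∩ Metric.closedBall (g • I) r) ∂μ
      = volume (Metric.closedBall I R) * μ (BB r) := by
  set A : Set (SL(2, ℝ) × ℍ) := {p | dist p.2 I ≤ R ∧ dist p.2 (p.1 • I) ≤ r} with hA
  have hc := proper_orbit.continuous
  have hAm : MeasurableSet A := by
    have h1 : IsClosed {p : SL(2, ℝ) × ℍ | dist p.2 I ≤ R} :=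
      isClosed_le (by fun_prop) continuous_const
    have h2 : IsClosed {p : SL(2, ℝ) × ℍ | dist p.2 (p.1 • I) ≤ r} :=
      isClosed_le (continuous_snd.dist (hc.comp continuous_fst)) continuous_const
    exact (h1.inter h2).measurableSet
  have e1 := Measure.prod_apply (μ := μ) (ν := (volume : Measure ℍ)) hAm
  have e2 := Measure.prod_apply_symm (μ := μ) (ν := (volume : Measure ℍ)) hAm
  have e3 : ∀ g : SL(2, ℝ), Prod.mk g ⁻¹' A =
      Metric.closedBall I R ∩ Metric.closedBall (g • I) r := by
    intro g; ext z; simp [hA]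
  simp_rw [e3] at e1
  rw [← e1, e2]
  have e4 : ∀ z : ℍ, μ ((fun x ↦ (x, z)) ⁻¹' A) =
      (Metric.closedBall I R).indicator (fun _ ↦ μ (BB r)) z := by
    intro z
    by_cases hz : z ∈ Metric.closedBall I R
    · rw [Set.indicator_of_mem hz, ← haar_ball μ z r]
      congr 1
      ext g
      simp only [Metric.mem_closedBall] at hz
      simp [hA, hz]
    · rw [Set.indicator_of_notMem hz]
      simp only [Metric.mem_closedBall] at hz
      simp [hA, hz]
  simp_rw [e4]
  rw [lintegral_indicator Metric.isClosed_closedBall.measurableSet]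
  simp [mul_comm]

lemma BB_meas (T : ℝ) : MeasurableSet (BB T) :=
  (isClosed_le (proper_orbit.continuous.dist continuous_const) continuous_const).measurableSet

lemma BB_fin (μ : Measure SL(2, ℝ)) [μ.IsHaarMeasure] (T : ℝ) : μ (BB T) ≠ ∞ := by
  have : IsCompact (BB T) := proper_orbit.isCompact_preimage (isCompact_closedBall I T)
  exact this.measure_lt_top.ne

lemma BB_pos (μ : Measure SL(2, ℝ)) [μ.IsHaarMeasure] (T : ℝ) (hT : 0 < T) : μ (BB T) ≠ 0 := by
  have : IsOpen {g : SL(2, ℝ) | dist (g • I) I < T} :=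
    isOpen_lt (proper_orbit.continuous.dist continuous_const) continuous_const
  have h := this.measure_pos μ ⟨1, by simpa using hT⟩
  exact (h.trans_le (measure_mono fun g (hg : dist (g • I) I < T) ↦ (le_of_lt hg : dist (g • I) I ≤ T))).ne'

lemma upper1 (μ : Measure SL(2, ℝ)) [μ.IsHaarMeasure] (T r : ℝ) :
    volume (Metric.closedBall I r) * μ (BB T) ≤
      volume (Metric.closedBall I (T + r)) * μ (BB r) := by
  rw [← fubini_id μ (T + r) r, ← setLIntegral_const]
  refine (lintegral_mono_ae ?_).trans (setLIntegral_le_lintegral (BB T) _)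
  filter_upwards [ae_restrict_mem (BB_meas T)] with g hg
  rw [← vol_ball g r]
  refine measure_mono fun z hz ↦ ⟨?_, hz⟩
  have := dist_triangle z (g • I) I
  simp only [BB, Metric.mem_closedBall, Set.mem_ofPred_eq] at *
  linarith

lemma lower1 (μ : Measure SL(2, ℝ)) [μ.IsHaarMeasure] (T r : ℝ) :
    volume (Metric.closedBall I (T - r)) * μ (BB r) ≤
      volume (Metric.closedBall I r) * μ (BB T) := by
  rw [← fubini_id μ (T - r) r, ← setLIntegral_const, ← lintegral_indicator (BB_meas T)]
  refine lintegral_mono fun g ↦ ?_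
  by_cases hg : g ∈ BB T
  · rw [Set.indicator_of_mem hg, ← vol_ball g r]
    exact measure_mono Set.inter_subset_right
  · rw [Set.indicator_of_notMem hg, nonpos_iff_eq_zero]
    suffices h : Metric.closedBall I (T - r) ∩ Metric.closedBall (g • I) r = ∅ by
      rw [h, measure_empty]
    ext z
    simp only [BB, Metric.mem_closedBall, Set.mem_ofPred_eq, Set.mem_inter_iff,
      Set.mem_empty_iff_false, iff_false, not_le, not_and] at *
    intro h
    have := dist_triangle (g • I) z I
    rw [dist_comm] at this
    rw [dist_comm z]
    linarith [dist_comm (g • I) z, dist_comm I (g • I)]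

lemma mem_ball_iff (z : ℍ) (T : ℝ) (hT : 0 ≤ T) : z ∈ Metric.closedBall I T ↔
    z.re ^ 2 + z.im ^ 2 + 1 ≤ 2 * Real.cosh T * z.im := by
  rw [Metric.mem_closedBall, ← abs_of_nonneg hT, ← abs_of_nonneg (dist_nonneg (x := z) (y := I)),
    ← Real.cosh_le_cosh, cosh_dist', abs_of_nonneg hT]
  have := z.im_pos
  simp only [I_re, I_im]
  rw [div_le_iff₀ (by positivity)]
  constructor <;> intro h <;> nlinarith

lemma vol_prod (T : ℝ) (hT : 0 ≤ T) : volume (Metric.closedBall I T) =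
    ∫⁻ p : ℝ × ℝ in {p | 0 < p.2 ∧ p.1 ^ 2 + p.2 ^ 2 + 1 ≤ 2 * Real.cosh T * p.2},
      ENNReal.ofReal ((1 / p.2) ^ 2) := by
  rw [volume_eq_lintegral, ← Complex.volume_preserving_equiv_real_prod.setLIntegral_comp_preimage_emb
    Complex.measurableEquivRealProd.measurableEmbedding]
  have : ((↑) '' Metric.closedBall I T : Set ℂ) = Complex.measurableEquivRealProd ⁻¹'
      {p | 0 < p.2 ∧ p.1 ^ 2 + p.2 ^ 2 + 1 ≤ 2 * Real.cosh T * p.2} := by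
    ext w
    simp only [Set.mem_image, mem_ball_iff _ _ hT, Set.mem_preimage, Set.mem_ofPred_eq,
      Complex.measurableEquivRealProd_apply]
    constructor
    · rintro ⟨z, hz, rfl⟩
      exact ⟨z.im_pos, hz⟩
    · rintro ⟨h1, h2⟩
      exact ⟨⟨w, h1⟩, h2, rfl⟩
  rw [this]
  refine lintegral_congr fun w ↦ ?_
  simp only [Complex.measurableEquivRealProd_apply]
  rw [← ENNReal.ofReal_coe_nnreal]
  congr 1
  simp

lemma vol_lower (T : ℝ) (hT : 1 / 2 ≤ T) :
    ENNReal.ofReal (1 / 24 * Real.exp T) ≤ volume (Metric.closedBall I T) := by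
  rw [vol_prod T (by linarith)]
  set a := Real.exp (-T) with ha
  have hapos : 0 < a := Real.exp_pos _
  have hea : Real.exp T = a⁻¹ := by rw [ha, Real.exp_neg, inv_inv]
  have ha2 : a ^ 2 ≤ 10 / 27 := by
    have h1 : a ^ 2 ≤ Real.exp (-1) := by
      rw [ha, ← Real.exp_nat_mul]; apply Real.exp_le_exp.2; push_cast; linarith
    have := Real.exp_one_gt_d9
    rw [Real.exp_neg] at h1
    refine h1.trans ?_
    rw [inv_le_comm₀ (by positivity) (by norm_num)]
    linarith
  have hcosh : 2 * Real.cosh T = a⁻¹ + a := by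
    rw [Real.cosh_eq, hea, ← ha]; ring
  have hsub : Set.Icc (0 : ℝ) (1 / 3) ×ˢ Set.Icc (3 / 2 * a) (2 * a) ⊆
      {p : ℝ × ℝ | 0 < p.2 ∧ p.1 ^ 2 + p.2 ^ 2 + 1 ≤ 2 * Real.cosh T * p.2} := by
    rintro ⟨x, y⟩ ⟨⟨hx0, hx1⟩, hy0, hy1⟩
    simp only [Set.mem_ofPred_eq] at *
    obtain ⟨s, rfl⟩ : ∃ s, y = s * a := ⟨y / a, by field_simp⟩
    have hs0 : 3 / 2 ≤ s := le_of_mul_le_mul_right hy0 hapos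
    have hs1 : s ≤ 2 := le_of_mul_le_mul_right hy1 hapos
    refine ⟨by positivity, ?_⟩
    rw [hcosh]
    have : (a⁻¹ + a) * (s * a) = s * (1 + a ^ 2) := by field_simp
    rw [this]
    have h1 : x ^ 2 ≤ 1 / 9 := by nlinarith
    have h2 : s * a ^ 2 ≤ 20 / 27 := by nlinarith
    nlinarith
  calc ENNReal.ofReal (1 / 24 * Real.exp T)
      ≤ ∫⁻ p : ℝ × ℝ in Set.Icc (0 : ℝ) (1 / 3) ×ˢ Set.Icc (3 / 2 * a) (2 * a),
        ENNReal.ofReal ((1 / (2 * a)) ^ 2) := by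
        rw [setLIntegral_const, Measure.volume_eq_prod, Measure.prod_prod, Real.volume_Icc,
          Real.volume_Icc, ← ENNReal.ofReal_mul (by norm_num), ← ENNReal.ofReal_mul (by positivity),
          hea]
        apply ENNReal.ofReal_le_ofReal
        have : (1 / (2 * a)) ^ 2 * ((1 / 3 - 0) * (2 * a - 3 / 2 * a)) = 1 / 24 * a⁻¹ := by
          field_simp; norm_num
        rw [this]
    _ ≤ ∫⁻ p : ℝ × ℝ in Set.Icc (0 : ℝ) (1 / 3) ×ˢ Set.Icc (3 / 2 * a) (2 * a),
        ENNReal.ofReal ((1 / p.2) ^ 2) := by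
        refine setLIntegral_mono' (measurableSet_Icc.prod measurableSet_Icc) ?_
        rintro ⟨x, y⟩ ⟨-, hy0, hy1⟩
        simp only at *
        have : 0 < y := by nlinarith
        apply ENNReal.ofReal_le_ofReal
        gcongr
    _ ≤ _ := lintegral_mono_set hsub

lemma vol_upper (T : ℝ) (hT : 0 ≤ T) :
    volume (Metric.closedBall I T) ≤ ENNReal.ofReal (16 * Real.exp T) := by
  rw [vol_prod T hT]
  set a := 2 * Real.cosh T with ha
  have hapos : 0 < a := by have := Real.cosh_pos T; positivity
  have ha2 : a ≤ 2 * Real.exp T := by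
    rw [ha, Real.cosh_eq]
    have : Real.exp (-T) ≤ Real.exp T := Real.exp_le_exp.2 (by linarith)
    linarith
  set S : Set (ℝ × ℝ) := {p | 1 / (2 * a) < p.2 ∧ p.1 ∈ Set.Icc (-√(a * p.2)) (√(a * p.2))} with hS
  have hsub : {p : ℝ × ℝ | 0 < p.2 ∧ p.1 ^ 2 + p.2 ^ 2 + 1 ≤ a * p.2} ⊆ S := by
    rintro ⟨x, y⟩ ⟨hy, h⟩
    simp only [hS, Set.mem_ofPred_eq] at *
    refine ⟨?_, ?_⟩
    · rw [div_lt_iff₀ (by positivity)]; nlinarith [sq_nonneg x, sq_nonneg y]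
    · rw [Set.mem_Icc, ← abs_le]
      apply Real.abs_le_sqrt
      nlinarith
  have hSm : MeasurableSet S := by
    have m1 : MeasurableSet {p : ℝ × ℝ | 1 / (2 * a) < p.2} :=
      measurableSet_lt measurable_const measurable_snd
    have m2 : MeasurableSet {p : ℝ × ℝ | -√(a * p.2) ≤ p.1} :=
      measurableSet_le (by fun_prop) (by fun_prop)
    have m3 : MeasurableSet {p : ℝ × ℝ | p.1 ≤ √(a * p.2)} :=
      measurableSet_le (by fun_prop) (by fun_prop)
    exact m1.inter (m2.inter m3)
  have hc : 0 < 1 / (2 * a) := by positivity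
  calc _ ≤ ∫⁻ p : ℝ × ℝ in S, ENNReal.ofReal ((1 / p.2) ^ 2) := lintegral_mono_set hsub
    _ = ∫⁻ y : ℝ, ∫⁻ x : ℝ, S.indicator (fun p ↦ ENNReal.ofReal ((1 / p.2) ^ 2)) (x, y) := by
        rw [← lintegral_indicator hSm, Measure.volume_eq_prod, lintegral_prod_symm]
        exact (Measurable.indicator (by fun_prop) hSm).aemeasurable
    _ = ∫⁻ y : ℝ in Set.Ioi (1 / (2 * a)), ENNReal.ofReal (2 * √a * y ^ (-3 / 2 : ℝ)) := by
        rw [← lintegral_indicator measurableSet_Ioi]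
        refine lintegral_congr fun y ↦ ?_
        by_cases hy : y ∈ Set.Ioi (1 / (2 * a))
        · rw [Set.indicator_of_mem hy]
          have hy0 : 0 < y := hc.trans hy
          have : ∀ x, S.indicator (fun p ↦ ENNReal.ofReal ((1 / p.2) ^ 2)) (x, y) =
              (Set.Icc (-√(a * y)) (√(a * y))).indicator
                (fun _ ↦ ENNReal.ofReal ((1 / y) ^ 2)) x := by
            intro x
            simp only [Set.indicator, hS, Set.mem_ofPred_eq, Set.mem_Ioi] at *
            simp only [hy, true_and]
          simp_rw [this]
          rw [lintegral_indicator measurableSet_Icc, setLIntegral_const, Real.volume_Icc,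
            ← ENNReal.ofReal_mul (by positivity)]
          congr 1
          rw [Real.sqrt_mul hapos.le, Real.sqrt_eq_rpow y]
          have : y ^ (-3 / 2 : ℝ) = y ^ (1 / 2 : ℝ) * (1 / y) ^ 2 := by
            rw [one_div y, inv_pow, ← Real.rpow_natCast, ← Real.rpow_neg hy0.le,
              ← Real.rpow_add hy0]
            norm_num
          rw [this]; ring
        · rw [Set.indicator_of_notMem hy]
          have : ∀ x, S.indicator (fun p ↦ ENNReal.ofReal ((1 / p.2) ^ 2)) (x, y) = 0 := by
            intro x
            apply Set.indicator_of_notMem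
            exact fun h ↦ hy h.1
          simp_rw [this]
          simp
    _ = ENNReal.ofReal (∫ y : ℝ in Set.Ioi (1 / (2 * a)), 2 * √a * y ^ (-3 / 2 : ℝ)) := by
        rw [ofReal_integral_eq_lintegral_ofReal]
        · exact (integrableOn_Ioi_rpow_of_lt (by norm_num) hc).const_mul _
        · filter_upwards [ae_restrict_mem measurableSet_Ioi] with y hy
          have hy0 : 0 < y := hc.trans hy
          positivity
    _ ≤ _ := by
        apply ENNReal.ofReal_le_ofReal
        rw [integral_const_mul, integral_Ioi_rpow_of_lt (by norm_num) hc]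
        have h1 : (1 / (2 * a)) ^ (-3 / 2 + 1 : ℝ) = √2 * √a := by
          rw [← Real.sqrt_mul (by norm_num), Real.sqrt_eq_rpow, one_div,
            Real.inv_rpow (by positivity), ← Real.rpow_neg (by positivity)]
          norm_num
        rw [h1]
        have h2 := Real.mul_self_sqrt hapos.le
        have h3 : √2 ≤ 2 := by rw [Real.sqrt_le_left (by norm_num)]; norm_num
        have : 2 * √a * (-(√2 * √a) / (-3 / 2 + 1)) = 4 * √2 * a := by
          linear_combination (4 * √2) * h2
        rw [this]
        nlinarith [Real.exp_pos T]

theorem statement9 (μ : Measure SL(2, ℝ)) [μ.IsHaarMeasure] :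
    ∃ c C : ℝ, 0 < c ∧ c ≤ C ∧
      ∀ T : ℝ, 1 ≤ T →
        ENNReal.ofReal (c * Real.exp T) ≤ μ {g : SL(2, ℝ) | dist (g • I) I ≤ T} ∧
        μ {g : SL(2, ℝ) | dist (g • I) I ≤ T} ≤ ENNReal.ofReal (C * Real.exp T) := by
  obtain ⟨m, hm0, hm⟩ : ∃ m : ℝ, 0 < m ∧ μ (BB (1 / 2)) = ENNReal.ofReal m :=
    ⟨(μ (BB (1 / 2))).toReal, ENNReal.toReal_pos (BB_pos μ _ (by norm_num)) (BB_fin μ _),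
      (ENNReal.ofReal_toReal (BB_fin μ _)).symm⟩
  have hlo := vol_lower (1 / 2) le_rfl
  have hup := vol_upper (1 / 2) (by norm_num)
  obtain ⟨v, hv0, hv⟩ : ∃ v : ℝ, 0 < v ∧
      volume (Metric.closedBall I (1 / 2)) = ENNReal.ofReal v := by
    have hf : volume (Metric.closedBall I (1 / 2)) ≠ ∞ := (hup.trans_lt ENNReal.ofReal_lt_top).ne
    refine ⟨_, ENNReal.toReal_pos ?_ hf, (ENNReal.ofReal_toReal hf).symm⟩
    exact ((ENNReal.ofReal_pos.2 (by positivity)).trans_le hlo).ne'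
  have key : ∀ T : ℝ, 1 ≤ T →
      ENNReal.ofReal (1 / 24 * Real.exp (-1 / 2) * m / v * Real.exp T) ≤ μ (BB T) ∧
        μ (BB T) ≤ ENNReal.ofReal (16 * Real.exp (1 / 2) * m / v * Real.exp T) := by
    intro T hT
    obtain ⟨b, hb0, hb⟩ : ∃ b : ℝ, 0 ≤ b ∧ μ (BB T) = ENNReal.ofReal b :=
      ⟨_, ENNReal.toReal_nonneg, (ENNReal.ofReal_toReal (BB_fin μ T)).symm⟩
    have h1 := upper1 μ T (1 / 2)
    have h2 := lower1 μ T (1 / 2)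
    have h3 := h1.trans (mul_le_mul_left (vol_upper (T + 1 / 2) (by linarith)) _)
    have h4 := (mul_le_mul_left (vol_lower (T - 1 / 2) (by linarith)) _).trans h2
    rw [hv, hm, hb, ← ENNReal.ofReal_mul (by positivity), ← ENNReal.ofReal_mul (by positivity),
      ENNReal.ofReal_le_ofReal_iff (by positivity)] at h3 h4
    rw [hb]
    constructor <;> apply ENNReal.ofReal_le_ofReal
    · rw [sub_eq_neg_add, Real.exp_add] at h4
      rw [div_mul_eq_mul_div, div_le_iff₀ hv0, neg_div]
      linarith
    · rw [Real.exp_add] at h3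
      rw [div_mul_eq_mul_div, le_div_iff₀ hv0]
      linarith
  refine ⟨_, _, ?_, ?_, key⟩
  · positivity
  · gcongr <;> norm_num
end
end

section
/- Let μ be a left Haar measure on SL(2,ℝ) and fix a ∈ (0,1]. Then there exists c > 0 such that for every T ≥ 1, ∫_{{g : dist(g•i, i) ≤ T}} e^{(a−1)·dist(g•i, i)} dμ(g) ≥ c·e^{aT}. -/
open scoped MatrixGroups ENNReal
open UpperHalfPlane MeasureTheory

noncomputable section

instance instContMulSL : ContinuousMul SL(2, ℝ) :=
  (@Matrix.SpecialLinearGroup.topologicalGroup (Fin 2) ℝ _ _ _ _ _).toContinuousMul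

/-- half the squared Frobenius norm -/
def hsq (g : SL(2, ℝ)) : ℝ := (g 0 0 ^ 2 + g 0 1 ^ 2 + g 1 0 ^ 2 + g 1 1 ^ 2) / 2

theorem continuous_val_SL : Continuous ((↑) : SL(2, ℝ) → Matrix (Fin 2) (Fin 2) ℝ) :=
  continuous_induced_dom

theorem continuous_entry_SL (i j : Fin 2) : Continuous (fun g : SL(2, ℝ) => g i j) :=
  (continuous_apply_apply i j).comp continuous_val_SL

theorem continuous_hsq : Continuous hsq := by
  have h := continuous_entry_SL
  unfold hsq
  exact ((((h 0 0).pow 2).add ((h 0 1).pow 2)).add ((h 1 0).pow 2)).add ((h 1 1).pow 2)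
    |>.div_const 2

theorem cosh_dist_eq_hsq (g : SL(2, ℝ)) : Real.cosh (dist (g • I) I) = hsq g := by
  have hdet : g 0 0 * g 1 1 - g 0 1 * g 1 0 = 1 := by
    have := g.det_coe
    rwa [Matrix.det_fin_two] at this
  have hpos : 0 < g 1 0 ^ 2 + g 1 1 ^ 2 := by
    rcases eq_or_ne (g 1 0) 0 with h | h
    · have : g 1 1 ≠ 0 := by
        intro h'
        rw [h, h'] at hdet
        simp at hdet
      positivity
    · positivity
  have hz : ((g • I : ℍ) : ℂ) = ((g 0 0 : ℂ) * Complex.I + g 0 1) / ((g 1 0 : ℂ) * Complex.I + g 1 1) := by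
    rw [coe_specialLinearGroup_apply]; simp
  have him : (g • I : ℍ).im = 1 / (g 1 0 ^ 2 + g 1 1 ^ 2) := by
    rw [← coe_im, hz, Complex.div_im]
    simp [Complex.normSq_apply]
    rw [← sub_div, hdet, one_div]
    congr 1
    ring
  have hre : (g • I : ℍ).re = (g 0 0 * g 1 0 + g 0 1 * g 1 1) / (g 1 0 ^ 2 + g 1 1 ^ 2) := by
    rw [← coe_re, hz, Complex.div_re]
    simp [Complex.normSq_apply]
    rw [← add_div]
    congr 1
    · linarith
    · ring
  rw [cosh_dist', him, hre, I_re, I_im, hsq]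
  generalize g 0 0 = a at *
  generalize g 0 1 = b at *
  generalize g 1 0 = c at *
  generalize g 1 1 = d at *
  have hne := hpos.ne'
  field_simp
  have : (a * c + b * d) ^ 2 + 1 = (a ^ 2 + b ^ 2) * (c ^ 2 + d ^ 2) := by
    have : (a * d - b * c) ^ 2 = 1 := by rw [hdet]; norm_num
    linarith
  linear_combination this

theorem one_le_hsq (g : SL(2, ℝ)) : 1 ≤ hsq g := by
  rw [← cosh_dist_eq_hsq]; exact Real.one_le_cosh _

theorem continuous_distI : Continuous (fun g : SL(2, ℝ) => dist (g • I) I) := by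
  have : (fun g : SL(2, ℝ) => dist (g • I) I) = fun g => Real.arcosh (hsq g) := by
    ext g
    rw [← cosh_dist_eq_hsq, Real.arcosh_cosh dist_nonneg]
  rw [this]
  exact Real.continuousOn_arcosh.comp_continuous continuous_hsq one_le_hsq

theorem isCompact_ballSL (T : ℝ) : IsCompact {g : SL(2, ℝ) | dist (g • I) I ≤ T} := by
  have hind : Topology.IsClosedEmbedding ((↑) : SL(2, ℝ) → Matrix (Fin 2) (Fin 2) ℝ) := by
    refine ⟨⟨⟨rfl⟩, Subtype.val_injective⟩, ?_⟩
    have : Set.range ((↑) : SL(2, ℝ) → Matrix (Fin 2) (Fin 2) ℝ) = {A | A.det = 1} := by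
      exact Subtype.range_val
    rw [this]
    exact isClosed_eq (continuous_id.matrix_det) continuous_const
  set R := 2 * Real.cosh T with hR
  have hK : IsCompact (Set.pi Set.univ fun _ : Fin 2 => Set.pi Set.univ fun _ : Fin 2 =>
      Set.Icc (-(R + 1)) (R + 1)) :=
    isCompact_univ_pi fun _ => isCompact_univ_pi fun _ => isCompact_Icc
  refine IsCompact.of_isClosed_subset (hind.isCompact_preimage hK)
    (isClosed_le continuous_distI continuous_const) ?_
  intro g hg
  have h1 : hsq g ≤ Real.cosh T := by
    rw [← cosh_dist_eq_hsq, Real.cosh_le_cosh, abs_of_nonneg dist_nonneg]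
    exact le_trans hg (le_abs_self T)
  have h2 : ∀ i j, g i j ^ 2 ≤ R := by
    unfold hsq at h1
    have := sq_nonneg (g 0 0)
    have := sq_nonneg (g 0 1)
    have := sq_nonneg (g 1 0)
    have := sq_nonneg (g 1 1)
    intro i j
    fin_cases i <;> fin_cases j <;> simp <;> linarith
  intro i _ j _
  have := h2 i j
  have hR0 : 0 ≤ R := le_trans (sq_nonneg _) this
  exact abs_le.1 (abs_le_of_sq_le_sq (by nlinarith) (by linarith))

theorem measure_translate (μ : Measure SL(2, ℝ)) [μ.IsHaarMeasure] (z : ℍ) (δ : ℝ) :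
    μ {g : SL(2, ℝ) | dist (g • I) z < δ} = μ {g : SL(2, ℝ) | dist (g • I) I < δ} := by
  rw [← measure_preimage_mul μ (z.toSL2R)]
  congr 1
  ext g
  simp only [Set.mem_preimage, Set.mem_ofPred_eq, mul_smul]
  nth_rewrite 2 [← toSL2R_smul_I z]
  rw [dist_smul]

theorem isOpen_translate (z : ℍ) (δ : ℝ) : IsOpen {g : SL(2, ℝ) | dist (g • I) z < δ} := by
  have : {g : SL(2, ℝ) | dist (g • I) z < δ} =
      (fun g => (z.toSL2R)⁻¹ * g) ⁻¹' {g : SL(2, ℝ) | dist (g • I) I < δ} := by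
    ext g
    simp only [Set.mem_preimage, Set.mem_ofPred_eq, mul_smul]
    rw [← dist_smul (z.toSL2R) _ I, smul_inv_smul, toSL2R_smul_I]
  rw [this]
  exact (isOpen_lt continuous_distI continuous_const).preimage (continuous_const_mul _)

/-- points on a low horocycle -/
def zpt (y : ℝ) (hy : 0 < y) (k : ℕ) : ℍ := ⟨⟨k * y, y⟩, hy⟩

theorem zpt_sep (y : ℝ) (hy : 0 < y) (j k : ℕ) (h : j ≠ k) :
    1 / 2 ≤ dist (zpt y hy j) (zpt y hy k) := by
  by_contra! hlt
  have h1 : Real.cosh (dist (zpt y hy j) (zpt y hy k)) ≤ Real.cosh (1 / 2) := by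
    rw [Real.cosh_le_cosh, abs_of_nonneg dist_nonneg, abs_of_pos (by norm_num)]
    exact hlt.le
  have h2 := Real.cosh_le_exp_half_sq (1 / 2)
  have h3 : Real.exp ((1 / 2) ^ 2 / 2) < 3 / 2 := by
    have h4 : Real.exp ((1 / 2) ^ 2 / 2) ^ 8 = Real.exp 1 := by
      rw [← Real.exp_nat_mul]; norm_num
    have h5 := Real.exp_one_lt_d9
    by_contra! h6
    have := pow_le_pow_left₀ (by norm_num) h6 8
    rw [h4] at this
    norm_num at this
    linarith
  have h7 : (1 : ℝ) ≤ ((j : ℝ) - k) ^ 2 := by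
    have : (1 : ℤ) ≤ ((j : ℤ) - k) ^ 2 := by
      have : (j : ℤ) - k ≠ 0 := by omega
      have := sq_pos_of_ne_zero this
      omega
    exact_mod_cast this
  rw [cosh_dist'] at h1
  have h8 : ((zpt y hy j).re - (zpt y hy k).re) ^ 2 + (zpt y hy j).im ^ 2 + (zpt y hy k).im ^ 2
      = (((j : ℝ) - k) ^ 2 + 2) * y ^ 2 := by
    change (j * y - k * y) ^ 2 + y ^ 2 + y ^ 2 = _
    ring
  have h9 : 2 * (zpt y hy j).im * (zpt y hy k).im = 2 * y ^ 2 := by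
    change 2 * y * y = _
    ring
  rw [h8, h9, mul_div_mul_right _ _ (by positivity)] at h1
  linarith

theorem zpt_dist (y : ℝ) (hy : 0 < y) (hy1 : y ≤ 1) (k : ℕ) (hk : k * y ≤ 1) :
    Real.exp (dist (zpt y hy k) I) ≤ 4 / y := by
  have h1 : Real.cosh (dist (zpt y hy k) I) = ((k * y) ^ 2 + y ^ 2 + 1) / (2 * y) := by
    rw [cosh_dist', I_re, I_im]
    change ((k * y - 0) ^ 2 + y ^ 2 + 1 ^ 2) / (2 * y * 1) = _
    simp
  have h2 : Real.exp (dist (zpt y hy k) I) ≤ 2 * Real.cosh (dist (zpt y hy k) I) := by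
    rw [Real.cosh_eq]
    have := Real.exp_pos (-dist (zpt y hy k) I)
    linarith
  refine h2.trans ?_
  rw [h1, ← mul_div_assoc, div_le_div_iff₀ (by positivity) hy]
  have h3 : (k * y) ^ 2 ≤ 1 := by
    have : 0 ≤ k * y := by positivity
    nlinarith
  have h4 : y ^ 2 ≤ 1 := by nlinarith
  nlinarith

theorem measure_ballSL_lower (μ : Measure SL(2, ℝ)) [μ.IsHaarMeasure] (T : ℝ) (hT : 1 ≤ T) :
    Real.exp (T - 3) * μ.real {g : SL(2, ℝ) | dist (g • I) I < 1 / 4} ≤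
      μ.real {g : SL(2, ℝ) | dist (g • I) I ≤ T} := by
  have hfin : μ {g : SL(2, ℝ) | dist (g • I) I ≤ T} ≠ ⊤ := (isCompact_ballSL T).measure_lt_top.ne
  rcases le_total T 3 with h3 | h3
  · have h1 : Real.exp (T - 3) ≤ 1 := Real.exp_le_one_iff.2 (by linarith)
    refine (mul_le_of_le_one_left measureReal_nonneg h1).trans ?_
    refine measureReal_mono ?_ hfin
    intro g hg
    rw [Set.mem_ofPred_eq] at hg ⊢
    linarith
  set y := Real.exp (3 - T) with hyd
  have hy : 0 < y := Real.exp_pos _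
  have hy1 : y ≤ 1 := Real.exp_le_one_iff.2 (by linarith)
  have hyinv : Real.exp (T - 3) = 1 / y := by
    rw [hyd, one_div, ← Real.exp_neg]; congr 1; ring
  set N := ⌊1 / y⌋₊ + 1 with hN
  have hNge : Real.exp (T - 3) ≤ N := by
    rw [hyinv, hN]; push_cast; exact (Nat.lt_floor_add_one _).le
  have hsub : (⋃ k ∈ Finset.range N, {g : SL(2, ℝ) | dist (g • I) (zpt y hy k) < 1 / 4}) ⊆
      {g : SL(2, ℝ) | dist (g • I) I ≤ T} := by
    intro g hg
    simp only [Set.mem_iUnion, Finset.mem_range] at hg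
    obtain ⟨k, hk, hg⟩ := hg
    have hg : dist (g • I) (zpt y hy k) < 1 / 4 := hg
    have hk' : (k : ℝ) ≤ 1 / y := (Nat.le_floor_iff (by positivity)).1 (by omega)
    have hky : k * y ≤ 1 := by rwa [le_div_iff₀ hy] at hk'
    have h1 := zpt_dist y hy hy1 k hky
    have h2 : 4 / y ≤ Real.exp (T - 1) := by
      have e : Real.exp (T - 1) = Real.exp 1 ^ 2 * (1 / y) := by
        rw [← hyinv, ← Real.exp_nat_mul, ← Real.exp_add]; congr 1; push_cast; ring
      rw [e, div_eq_mul_one_div]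
      have := Real.exp_one_gt_d9
      gcongr
      nlinarith
    have h3 := Real.exp_le_exp.1 (h1.trans h2)
    have h4 := dist_triangle (g • I) (zpt y hy k) I
    rw [Set.mem_ofPred_eq]
    linarith
  have hdisj : (Finset.range N : Set ℕ).PairwiseDisjoint
      (fun k => {g : SL(2, ℝ) | dist (g • I) (zpt y hy k) < 1 / 4}) := by
    intro j _ k _ hjk
    refine Set.disjoint_left.2 ?_
    intro g h1 h2
    rw [Set.mem_ofPred_eq] at h1 h2
    have h3 := zpt_sep y hy j k hjk
    have h4 := dist_triangle_left (zpt y hy j) (zpt y hy k) (g • I)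
    linarith
  have hU := measure_biUnion_finset (μ := μ) hdisj
    (fun k _ => (isOpen_translate (zpt y hy k) (1 / 4)).measurableSet)
  simp only [measure_translate, Finset.sum_const, Finset.card_range] at hU
  have hle := measure_mono (μ := μ) hsub
  rw [hU] at hle
  have := ENNReal.toReal_mono hfin hle
  rw [nsmul_eq_mul, ENNReal.toReal_mul, ENNReal.toReal_natCast] at this
  exact (mul_le_mul_of_nonneg_right hNge measureReal_nonneg).trans this

theorem statement10 (μ : Measure SL(2, ℝ)) [μ.IsHaarMeasure] (a : ℝ) (ha : 0 < a) (ha' : a ≤ 1) :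
    ∃ c : ℝ, 0 < c ∧
      ∀ T : ℝ, 1 ≤ T →
        c * Real.exp (a * T) ≤
          ∫ g in {g : SL(2, ℝ) | dist (g • I) I ≤ T},
            Real.exp ((a - 1) * dist (g • I) I) ∂μ := by
  have hopen : IsOpen {g : SL(2, ℝ) | dist (g • I) I < 1 / 4} :=
    isOpen_lt continuous_distI continuous_const
  have hpos : 0 < μ.real {g : SL(2, ℝ) | dist (g • I) I < 1 / 4} := by
    refine ENNReal.toReal_pos (hopen.measure_pos μ ⟨1, by simp⟩).ne' ?_
    refine ((measure_mono ?_).trans_lt (isCompact_ballSL 1).measure_lt_top).ne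
    intro g hg
    rw [Set.mem_ofPred_eq] at hg ⊢
    linarith
  refine ⟨Real.exp (-3) * μ.real {g : SL(2, ℝ) | dist (g • I) I < 1 / 4}, by positivity, ?_⟩
  intro T hT
  have hK := isCompact_ballSL T
  have hfin := hK.measure_lt_top (μ := μ)
  have hms : MeasurableSet {g : SL(2, ℝ) | dist (g • I) I ≤ T} :=
    (isClosed_le continuous_distI continuous_const).measurableSet
  have hcont : Continuous fun g : SL(2, ℝ) => Real.exp ((a - 1) * dist (g • I) I) :=
    Real.continuous_exp.comp (continuous_const.mul continuous_distI)
  have hint : IntegrableOn (fun g : SL(2, ℝ) => Real.exp ((a - 1) * dist (g • I) I))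
      {g : SL(2, ℝ) | dist (g • I) I ≤ T} μ := by
    refine Measure.integrableOn_of_bounded (M := 1) hfin.ne
      hcont.measurable.aestronglyMeasurable ?_
    refine Filter.Eventually.of_forall fun g => ?_
    rw [Real.norm_eq_abs, abs_of_pos (Real.exp_pos _), Real.exp_le_one_iff]
    exact mul_nonpos_of_nonpos_of_nonneg (by linarith) dist_nonneg
  have h1 : ∫ g in {g : SL(2, ℝ) | dist (g • I) I ≤ T}, Real.exp ((a - 1) * T) ∂μ ≤
      ∫ g in {g : SL(2, ℝ) | dist (g • I) I ≤ T}, Real.exp ((a - 1) * dist (g • I) I) ∂μ := by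
    refine setIntegral_mono_on (integrableOn_const hfin.ne) hint hms ?_
    intro g hg
    rw [Set.mem_ofPred_eq] at hg
    exact Real.exp_le_exp.2 (mul_le_mul_of_nonpos_left hg (by linarith))
  refine le_trans ?_ h1
  rw [setIntegral_const, smul_eq_mul]
  refine le_trans (le_of_eq ?_)
    (mul_le_mul_of_nonneg_right (measure_ballSL_lower μ T hT) (Real.exp_pos _).le)
  have : Real.exp (-3) * Real.exp (a * T) = Real.exp (T - 3) * Real.exp ((a - 1) * T) := by
    rw [← Real.exp_add, ← Real.exp_add]; congr 1; ring
  linear_combination (μ.real {g : SL(2, ℝ) | dist (g • I) I < 1 / 4}) * this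
end
end
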